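/- Fix ℓ ∈ ℕ. Let t₁, …, t_{2ℓ+5} be pairwise distinct complex numbers and let X = ⋃_{j=1}^{2ℓ+5} {(z,w) ∈ ℂ² : w = t_j·z}. Then there do not exist an open neighborhood U of the origin in ℂ² and a holomorphic map H : U → Mat(2×2,ℂ) such that H(0,0) is invertible and A(ζ)H(ζ) = H(ζ)B(ζ) for all ζ ∈ X ∩ U. In other words, the restrictions of A and B to X are not locally holomorphically similar at the origin. -/

import Mathlib

/-- `A(z,w) = [[z^{2+ℓ}·w^{2+ℓ}, z^{3+ℓ}],[w^{3+ℓ}, 0]]`. -/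
noncomputable def matA (ℓ : ℕ) (p : ℂ × ℂ) : Matrix (Fin 2) (Fin 2) ℂ :=
  !![p.1 ^ (2 + ℓ) * p.2 ^ (2 + ℓ), p.1 ^ (3 + ℓ); p.2 ^ (3 + ℓ), 0]

/-- `B(z,w) = [[0, z^{3+ℓ}],[w^{3+ℓ}, z^{2+ℓ}·w^{2+ℓ}]]`. -/
noncomputable def matB (ℓ : ℕ) (p : ℂ × ℂ) : Matrix (Fin 2) (Fin 2) ℂ :=
  !![0, p.1 ^ (3 + ℓ); p.2 ^ (3 + ℓ), p.1 ^ (2 + ℓ) * p.2 ^ (2 + ℓ)]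

open Filter Topology Metric Asymptotics Polynomial

/-- A bounded function on the open bidisc of radius `r` that is holomorphic in each variable. -/
structure IsBoundedSepHolo (r : ℝ) (f : ℂ → ℂ → ℂ) : Prop where
  fst : ∀ w ∈ ball (0 : ℂ) r, DifferentiableOn ℂ (fun z => f z w) (ball 0 r)
  snd : ∀ z ∈ ball (0 : ℂ) r, DifferentiableOn ℂ (f z) (ball 0 r)
  bdd : ∃ M, ∀ z ∈ ball (0 : ℂ) r, ∀ w ∈ ball (0 : ℂ) r, ‖f z w‖ ≤ M

/-- Difference quotients in the second variable of a uniformly bounded family of holomorphic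
functions are uniformly bounded. -/
theorem exists_norm_dslope_le {r : ℝ} {f : ℂ → ℂ → ℂ}
    (hf : ∀ z ∈ ball (0 : ℂ) r, DifferentiableOn ℂ (f z) (ball 0 r))
    (hM : ∃ M, ∀ z ∈ ball (0 : ℂ) r, ∀ w ∈ ball (0 : ℂ) r, ‖f z w‖ ≤ M) :
    ∃ M, ∀ z ∈ ball (0 : ℂ) r, ∀ w ∈ ball (0 : ℂ) r, ‖dslope (f z) 0 w‖ ≤ M := by
  obtain ⟨M, hM⟩ := hM
  refine ⟨(2 * M) / r, fun z hz w hw =>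
    Complex.norm_dslope_le_div_of_mapsTo_ball (hf z hz) (fun v hv => ?_) hw⟩
  have h0 : (0 : ℂ) ∈ ball (0 : ℂ) r := mem_ball_self (pos_of_mem_ball hw)
  rw [mem_closedBall, dist_eq_norm]
  linarith [norm_sub_le (f z v) (f z 0), hM z hz v hv, hM z hz 0 h0]

theorem IsBoundedSepHolo.dslope {r : ℝ} (hr : 0 < r) {f : ℂ → ℂ → ℂ}
    (hf : IsBoundedSepHolo r f) : IsBoundedSepHolo r (fun z w => dslope (f z) 0 w) := by
  have h0 : (0 : ℂ) ∈ ball (0 : ℂ) r := mem_ball_self hr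
  have hsnd : ∀ z ∈ ball (0 : ℂ) r, DifferentiableOn ℂ (_root_.dslope (f z) 0) (ball 0 r) :=
    fun z hz => (Complex.differentiableOn_dslope (ball_mem_nhds 0 hr)).2 (hf.snd z hz)
  have hbdd := exists_norm_dslope_le hf.snd hf.bdd
  have hne : ∀ w ∈ ball (0 : ℂ) r, w ≠ 0 →
      DifferentiableOn ℂ (fun z => _root_.dslope (f z) 0 w) (ball 0 r) := by
    intro w hw hw0
    simp only [dslope_of_ne _ hw0, slope_def_field]
    exact ((hf.fst w hw).sub (hf.fst 0 h0)).div_const _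
  refine ⟨fun w hw => ?_, hsnd, hbdd⟩
  rcases eq_or_ne w 0 with rfl | hw0
  swap
  · exact hne w hw hw0
  obtain ⟨C, hC⟩ := exists_norm_dslope_le (f := fun z => _root_.dslope (f z) 0) hsnd hbdd
  have hunif : TendstoUniformlyOn (fun w z => _root_.dslope (f z) 0 w)
      (fun z => _root_.dslope (f z) 0 0) (𝓝[≠] (0 : ℂ)) (ball 0 r) := by
    rw [Metric.tendstoUniformlyOn_iff]
    intro ε hε
    have hlim : Tendsto (fun w : ℂ => ‖w‖ * C) (𝓝[≠] 0) (𝓝 0) := by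
      have : Continuous fun w : ℂ => ‖w‖ * C := by fun_prop
      simpa using (this.tendsto 0).mono_left nhdsWithin_le_nhds
    filter_upwards [hlim.eventually_lt_const hε,
      nhdsWithin_le_nhds (ball_mem_nhds (0 : ℂ) hr)] with w hwε hw z hz
    rw [dist_comm, dist_eq_norm, ← sub_smul_dslope, norm_smul, sub_zero]
    exact (mul_le_mul_of_nonneg_left (hC z hz w hw) (norm_nonneg _)).trans_lt hwε
  refine hunif.tendstoLocallyUniformlyOn.differentiableOn ?_ isOpen_ball
  filter_upwards [self_mem_nhdsWithin, nhdsWithin_le_nhds (ball_mem_nhds (0 : ℂ) hr)] with w h1 h2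
  exact hne w h2 h1

theorem AnalyticAt.exists_isBigO_sub_sum_pow {g : ℂ → ℂ} (hg : AnalyticAt ℂ g 0) (K : ℕ) :
    ∃ a : ℕ → ℂ, (fun z => g z - ∑ n ∈ Finset.range K, a n * z ^ n) =O[𝓝 0] fun z => z ^ K := by
  obtain ⟨p, hp⟩ := hg
  refine ⟨p.coeff, ?_⟩
  have h := hp.isBigO_sub_partialSum_pow K
  simp only [zero_add, FormalMultilinearSeries.partialSum,
    FormalMultilinearSeries.apply_eq_pow_smul_coeff, smul_eq_mul, mul_comm _ (p.coeff _),
    ← norm_pow] at h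
  exact h.of_norm_right

/-- The Taylor coefficients at `0` of `z ↦ f (z, t z)` are polynomials in `t`, the `n`-th one of
degree at most `n`. -/
theorem IsBoundedSepHolo.exists_polynomial_coeff {r : ℝ} (hr : 0 < r) (K : ℕ) {f : ℂ → ℂ → ℂ}
    (hf : IsBoundedSepHolo r f) :
    ∃ P : ℕ → ℂ[X], (∀ n, (P n).natDegree ≤ n) ∧ ∀ t : ℂ,
      (fun z => f z (t * z) - ∑ n ∈ Finset.range K, (P n).eval t * z ^ n)
        =O[𝓝 0] fun z => z ^ K := by
  induction K generalizing f with
  | zero =>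
    refine ⟨0, by simp, fun t => ?_⟩
    obtain ⟨M, hM⟩ := hf.bdd
    have ht : Tendsto (fun z : ℂ => t * z) (𝓝 0) (𝓝 0) := by
      simpa using (continuous_const_mul t).tendsto 0
    refine IsBigO.of_bound M ?_
    filter_upwards [ball_mem_nhds (0 : ℂ) hr, ht (ball_mem_nhds (0 : ℂ) hr)] with z hz htz
    simpa using hM z hz _ htz
  | succ K ih =>
    obtain ⟨P, hP, hPO⟩ := ih (hf.dslope hr)
    obtain ⟨a, ha⟩ := ((hf.fst 0 (mem_ball_self hr)).analyticAt
      (ball_mem_nhds 0 hr)).exists_isBigO_sub_sum_pow (K + 1)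
    refine ⟨fun n => C (a n) + if n = 0 then 0 else X * P (n - 1), fun n => ?_, fun t => ?_⟩
    · refine natDegree_add_le_of_degree_le (by simp) ?_
      split_ifs with hn
      · simp
      · refine natDegree_mul_le.trans ?_
        have := hP (n - 1)
        rw [natDegree_X]
        omega
    · have h := ((hPO t).mul (isBigO_refl (fun z : ℂ => z) _)).const_mul_left t
      simp only [← pow_succ] at h
      refine (ha.add h).congr_left fun z => ?_
      have hz := sub_smul_dslope (f z) 0 (t * z)
      rw [sub_zero, smul_eq_mul] at hz
      have hsum : ∑ n ∈ Finset.range (K + 1),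
          (C (a n) + if n = 0 then 0 else X * P (n - 1)).eval t * z ^ n =
          ∑ n ∈ Finset.range (K + 1), a n * z ^ n
            + t * z * ∑ n ∈ Finset.range K, (P n).eval t * z ^ n := by
        simp only [eval_add, eval_C, add_mul, Finset.sum_add_distrib]
        congr 1
        rw [Finset.sum_range_succ', Finset.mul_sum]
        simp only [Nat.succ_ne_zero, if_false, if_true, eval_zero, zero_mul, add_zero, eval_mul,
          eval_X, Nat.add_sub_cancel]
        exact Finset.sum_congr rfl fun n _ => by ring
      rw [hsum]
      linear_combination hz

theorem eq_zero_of_sum_pow_isBigO {K : ℕ} {e : ℕ → ℂ}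
    (h : (fun z : ℂ => ∑ n ∈ Finset.range K, e n * z ^ n) =O[𝓝[≠] 0] fun z => z ^ K) :
    ∀ n < K, e n = 0 := by
  induction K generalizing e with
  | zero => simp
  | succ K ih =>
    have h1 : Tendsto (fun z : ℂ => z ^ (K + 1)) (𝓝[≠] 0) (𝓝 0) := by
      simpa using ((continuous_pow (M := ℂ) (K + 1)).tendsto 0).mono_left nhdsWithin_le_nhds
    have h2 : Tendsto (fun z : ℂ => ∑ n ∈ Finset.range (K + 1), e n * z ^ n) (𝓝[≠] 0)
        (𝓝 (e 0)) := by
      have hc : Continuous fun z : ℂ => ∑ n ∈ Finset.range (K + 1), e n * z ^ n := by fun_prop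
      have := (hc.tendsto 0).mono_left (nhdsWithin_le_nhds (s := {0}ᶜ))
      simpa [Finset.sum_range_succ'] using this
    have h0 : e 0 = 0 := tendsto_nhds_unique h2 (h.trans_tendsto h1)
    have h3 : (fun z : ℂ => ∑ n ∈ Finset.range K, e (n + 1) * z ^ n)
        =O[𝓝[≠] 0] fun z => z ^ K := by
      refine (h.mul (isBigO_refl (fun z : ℂ => z⁻¹) _)).congr' ?_ ?_
      · filter_upwards [self_mem_nhdsWithin] with z hz
        have hz : z ≠ 0 := hz
        rw [Finset.sum_range_succ', h0, zero_mul, add_zero, Finset.sum_mul]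
        exact Finset.sum_congr rfl fun n _ => by field_simp; ring
      · filter_upwards [self_mem_nhdsWithin] with z hz
        have hz : z ≠ 0 := hz
        field_simp
        ring
    rintro (_ | n) hn
    · exact h0
    · exact ih h3 n (by omega)

theorem DifferentiableOn.exists_isBoundedSepHolo {U : Set (ℂ × ℂ)} {f : ℂ × ℂ → ℂ}
    (hU : IsOpen U) (h0 : (0, 0) ∈ U) (hf : DifferentiableOn ℂ f U) :
    ∃ r > 0, IsBoundedSepHolo r (fun z w => f (z, w)) := by
  have hc : ContinuousAt f (0, 0) := (hf.differentiableAt (hU.mem_nhds h0)).continuousAt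
  have hev : ∀ᶠ p in 𝓝 ((0 : ℂ), (0 : ℂ)), ‖f p‖ < ‖f (0, 0)‖ + 1 ∧ p ∈ U :=
    (hc.norm.eventually_lt_const (lt_add_one _)).and (hU.mem_nhds h0)
  obtain ⟨r, hr, hball⟩ := Metric.eventually_nhds_iff_ball.1 hev
  rw [← ball_prod_same] at hball
  refine ⟨r, hr, fun w hw => ?_, fun z hz => ?_, _, fun z hz w hw => (hball (z, w) ⟨hz, hw⟩).1.le⟩
  · exact hf.comp (by fun_prop) fun z hz => (hball (z, w) ⟨hz, hw⟩).2
  · exact hf.comp (by fun_prop) fun w hw => (hball (z, w) ⟨hz, hw⟩).2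

/-- The Taylor coefficients at `0` of `z ↦ f (z, t z)` are polynomials in `t`, the `n`-th one of
degree at most `n`, and the `0`-th one is `f (0, 0)`. -/
theorem DifferentiableOn.exists_polynomial_coeff {U : Set (ℂ × ℂ)} {f : ℂ × ℂ → ℂ}
    (hU : IsOpen U) (h0 : (0, 0) ∈ U) (hf : DifferentiableOn ℂ f U) {K : ℕ} (hK : 0 < K) :
    ∃ P : ℕ → ℂ[X], (∀ n, (P n).natDegree ≤ n) ∧ P 0 = C (f (0, 0)) ∧ ∀ t : ℂ,
      (fun z => f (z, t * z) - ∑ n ∈ Finset.range K, (P n).eval t * z ^ n)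
        =O[𝓝 0] fun z => z ^ K := by
  obtain ⟨r, hr, hS⟩ := hf.exists_isBoundedSepHolo hU h0
  obtain ⟨P, hP, hPO⟩ := hS.exists_polynomial_coeff hr K
  refine ⟨P, hP, ?_, hPO⟩
  have h := (hPO 0).eq_zero_imp.self_of_nhds (zero_pow hK.ne')
  obtain ⟨K, rfl⟩ := Nat.exists_eq_succ_of_ne_zero hK.ne'
  have hC := eq_C_of_natDegree_le_zero (hP 0)
  simp only [Finset.sum_range_succ', mul_zero, pow_zero, mul_one, ne_eq,
    Nat.succ_ne_zero, not_false_eq_true, zero_pow, Finset.sum_const_zero, zero_add] at h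
  rw [hC, eval_C] at h
  rw [hC, sub_eq_zero.1 h]

/-- If `z^(ℓ+1) t^(ℓ+2) a = t^(ℓ+3) b - c` on `2ℓ+5` distinct lines `w = t z` near the origin, then
`a` and `b` vanish at the origin: comparing the coefficients of `z^(ℓ+1)` and of `z^0` gives
polynomials in `t` of degree at most `2ℓ+4` with `2ℓ+5` roots. -/
theorem apply_zero_eq_zero_of_relation_on_lines {ℓ : ℕ} {t : Fin (2 * ℓ + 5) → ℂ}
    (ht : Function.Injective t) {U : Set (ℂ × ℂ)} {a b c : ℂ × ℂ → ℂ} (hU : IsOpen U)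
    (h0 : (0, 0) ∈ U) (ha : DifferentiableOn ℂ a U) (hb : DifferentiableOn ℂ b U)
    (hc : DifferentiableOn ℂ c U)
    (h : ∀ j, ∀ᶠ z in 𝓝[≠] (0 : ℂ), z ^ (ℓ + 1) * t j ^ (ℓ + 2) * a (z, t j * z) =
      t j ^ (ℓ + 3) * b (z, t j * z) - c (z, t j * z)) :
    a (0, 0) = 0 ∧ b (0, 0) = 0 := by
  obtain ⟨A, -, hA0, hAO⟩ := ha.exists_polynomial_coeff hU h0 one_pos
  obtain ⟨B, hB, hB0, hBO⟩ := hb.exists_polynomial_coeff hU h0 (Nat.succ_pos (ℓ + 1))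
  obtain ⟨D, hD, hD0, hDO⟩ := hc.exists_polynomial_coeff hU h0 (Nat.succ_pos (ℓ + 1))
  let q : ℕ → ℂ[X] := fun n =>
    X ^ (ℓ + 3) * B n - D n - if n = ℓ + 1 then C (a (0, 0)) * X ^ (ℓ + 2) else 0
  have heval : ∀ j, ∀ n < ℓ + 2, (q n).eval (t j) = 0 := by
    intro j
    refine eq_zero_of_sum_pow_isBigO (e := fun n => (q n).eval (t j)) ?_
    have hA' := ((hAO (t j)).mul (isBigO_refl (fun z : ℂ => z ^ (ℓ + 1)) _)).const_mul_left
      (t j ^ (ℓ + 2))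
    simp only [← pow_add, add_comm 1 (ℓ + 1)] at hA'
    have key := ((hA'.add (hDO (t j))).sub ((hBO (t j)).const_mul_left (t j ^ (ℓ + 3)))).mono
      (nhdsWithin_le_nhds (s := {0}ᶜ))
    refine key.congr' ?_ EventuallyEq.rfl
    filter_upwards [h j] with z hz
    have hsum : ∑ n ∈ Finset.range (ℓ + 2), (q n).eval (t j) * z ^ n =
        t j ^ (ℓ + 3) * ∑ n ∈ Finset.range (ℓ + 2), (B n).eval (t j) * z ^ n
          - ∑ n ∈ Finset.range (ℓ + 2), (D n).eval (t j) * z ^ n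
          - a (0, 0) * t j ^ (ℓ + 2) * z ^ (ℓ + 1) := by
      simp only [q, eval_sub, sub_mul, Finset.sum_sub_distrib, Finset.mul_sum, eval_mul, eval_pow,
        eval_X, mul_assoc]
      congr 1
      rw [Finset.sum_eq_single (ℓ + 1)]
      · simp [mul_assoc]
      · intro n _ hn
        simp [hn]
      · simp
    rw [hsum]
    simp only [Finset.sum_range_one, hA0, eval_C, pow_zero, mul_one]
    linear_combination hz
  have hq : ∀ n < ℓ + 2, q n = 0 := by
    intro n hn
    refine eq_zero_of_natDegree_lt_card_of_eval_eq_zero (q n) ht (fun j => heval j n hn) ?_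
    rw [Fintype.card_fin, Nat.lt_succ_iff]
    have h1 := hB n
    have h2 := hD n
    refine natDegree_sub_le_of_le (natDegree_sub_le_of_le (natDegree_mul_le.trans ?_) ?_) ?_ |>.trans
      (max_le (max_le le_rfl le_rfl) le_rfl)
    · rw [natDegree_X_pow]
      omega
    · omega
    · split_ifs
      · exact (natDegree_C_mul_X_pow_le _ _).trans (by omega)
      · simp
  constructor
  · have h1 := congrArg (coeff · (ℓ + 2)) (hq (ℓ + 1) (by omega))
    have h2 : (D (ℓ + 1)).coeff (ℓ + 2) = 0 :=
      coeff_eq_zero_of_natDegree_lt ((hD _).trans_lt (by omega))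
    simpa [q, coeff_X_pow_mul', h2] using h1
  · have h1 := congrArg (coeff · (ℓ + 3)) (hq 0 (by omega))
    simpa [q, coeff_X_pow_mul', hB0, hD0, coeff_C] using h1

/-- On a union `X` of `2ℓ+5` pairwise distinct lines `{w = t_j·z}` through the origin of `ℂ²`,
the restrictions of `A` and `B` to `X` are not locally holomorphically similar at the origin:
no holomorphic `H` near the origin has `H(0,0)` invertible and `AH = HB` on `X ∩ U`. -/
theorem not_locally_similar_on_lines (ℓ : ℕ) (t : Fin (2 * ℓ + 5) → ℂ)
    (ht : Function.Injective t) :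
    ¬ ∃ (U : Set (ℂ × ℂ)) (H : ℂ × ℂ → Matrix (Fin 2) (Fin 2) ℂ),
      IsOpen U ∧ (0, 0) ∈ U ∧
      (∀ i j, DifferentiableOn ℂ (fun ζ => H ζ i j) U) ∧
      IsUnit (H (0, 0)) ∧
      (∀ ζ ∈ U, (∃ j, ζ.2 = t j * ζ.1) → matA ℓ ζ * H ζ = H ζ * matB ℓ ζ) := by
  rintro ⟨U, H, hU, h0, hH, hunit, hrel⟩
  have key := apply_zero_eq_zero_of_relation_on_lines ht hU h0 (hH 0 0) (hH 0 1) (hH 1 0) ?_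
  · rw [Matrix.isUnit_iff_isUnit_det, Matrix.det_fin_two, key.1, key.2] at hunit
    simp at hunit
  intro j
  have hline : Tendsto (fun z : ℂ => (z, t j * z)) (𝓝 0) (𝓝 (0, 0)) := by
    have : Continuous fun z : ℂ => (z, t j * z) := by fun_prop
    simpa using this.tendsto 0
  filter_upwards [self_mem_nhdsWithin, nhdsWithin_le_nhds (hline (hU.mem_nhds h0))] with z hz hzU
  have hz : z ≠ 0 := hz
  have h := congrFun₂ (hrel (z, t j * z) hzU ⟨j, rfl⟩) 0 0
  simp only [matA, matB, Matrix.mul_apply, Fin.sum_univ_two, Matrix.of_apply, Matrix.cons_val_zero,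
    Matrix.cons_val_one, mul_zero, zero_add] at h
  refine mul_left_cancel₀ (pow_ne_zero (ℓ + 3) hz) ?_
  rw [mul_pow, mul_pow] at h
  linear_combination h
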